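/- arXiv:2112.11668 — 3 statements merged into one kernel-verified Lean document; each statement's English description precedes it below -/
import Mathlib

section
/- Lemma 1 (conditional InfoNCE lower bound), finite version. Let 𝒳, 𝒴, 𝒮, 𝒯 be finite nonempty types, let p be a strictly positive probability mass function on 𝒳 × 𝒴, and let F_s : 𝒳 → 𝒮 and F_t : 𝒳 → 𝒯 be functions. For y ∈ 𝒴 write p(y) = Σ_x p(x,y) and p(x|y) = p(x,y)/p(y). Fix an integer N ≥ 1 and, for each y ∈ 𝒴, a score function f_y : 𝒮 × 𝒯 → ℝ. Define −L_info = Σ_{y ∈ 𝒴} p(y) · Σ_{(x_1,…,x_N) ∈ 𝒳^N} (Π_{i=1}^N p(x_i|y)) · (1/N) · Σ_{i=1}^N log( N · exp(f_y(F_s(x_i), F_t(x_i))) / Σ_{j=1}^N exp(f_y(F_s(x_i), F_t(x_j))) ). Then −L_info ≤ I(S;T | Y), the conditional mutual information of S = F_s(X) and T = F_t(X) given Y, where (X,Y) is distributed according to p. -/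
noncomputable section

open Finset

/-- Marginal `p_Y(y) = Σ_x p(x,y)` of a pmf on `𝒳 × 𝒴`. -/
def margY {X Y : Type*} [Fintype X] (p : X × Y → ℝ) (y : Y) : ℝ :=
  ∑ x, p (x, y)

/-- Conditional `p(x|y) = p(x,y) / p_Y(y)`. -/
def condX {X Y : Type*} [Fintype X] (p : X × Y → ℝ) (x : X) (y : Y) : ℝ :=
  p (x, y) / margY p y

/-- Joint pmf of `(S,T,Y)` induced by `p`, `F_s`, `F_t`:
`p_{S,T,Y}(s,t,y) = Σ_{x : F_s x = s, F_t x = t} p(x,y)`. -/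
def jointSTY {X Y S T : Type*} [Fintype X] [DecidableEq S] [DecidableEq T]
    (p : X × Y → ℝ) (Fs : X → S) (Ft : X → T) (s : S) (t : T) (y : Y) : ℝ :=
  ∑ x, if Fs x = s ∧ Ft x = t then p (x, y) else 0

/-- Conditional mutual information `I(S;T|Y)` of `S = F_s(X)` and `T = F_t(X)` given `Y`,
where `(X,Y) ~ p`:
`Σ_y p_Y(y) · Σ_{s,t} p(s,t|y) · log (p(s,t|y) / (p(s|y) · p(t|y)))`
(terms with `p(s,t|y) = 0` vanish since they are multiplied by `0`). -/
def condMutualInfo {X Y S T : Type*} [Fintype X] [Fintype Y] [Fintype S] [Fintype T]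
    [DecidableEq S] [DecidableEq T] (p : X × Y → ℝ) (Fs : X → S) (Ft : X → T) : ℝ :=
  ∑ y, margY p y * ∑ s, ∑ t,
    (jointSTY p Fs Ft s t y / margY p y) *
      Real.log ((jointSTY p Fs Ft s t y / margY p y) /
        (((∑ t', jointSTY p Fs Ft s t' y) / margY p y) *
          ((∑ s', jointSTY p Fs Ft s' t y) / margY p y)))

/-- The conditional InfoNCE objective `−L_info`:
`Σ_y p(y) · Σ_{(x_1,…,x_N)} (Π_i p(x_i|y)) · (1/N) Σ_i
  log (N · e^{f_y(F_s x_i, F_t x_i)} / Σ_j e^{f_y(F_s x_i, F_t x_j)})`. -/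
def negLinfo {X Y S T : Type*} [Fintype X] [Fintype Y]
    (p : X × Y → ℝ) (Fs : X → S) (Ft : X → T) (N : ℕ) (f : Y → S × T → ℝ) : ℝ :=
  ∑ y, margY p y * ∑ xs : Fin N → X, (∏ i, condX p (xs i) y) *
    ((1 / (N : ℝ)) * ∑ i, Real.log ((N : ℝ) * Real.exp (f y (Fs (xs i), Ft (xs i))) /
      ∑ j, Real.exp (f y (Fs (xs i), Ft (xs j)))))

/-- Pushforward of a mass function `q` along `x ↦ (Fs x, Ft x)`. -/
def pushPair {X S T : Type*} [Fintype X] [DecidableEq S] [DecidableEq T]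
    (q : X → ℝ) (Fs : X → S) (Ft : X → T) (s : S) (t : T) : ℝ :=
  ∑ x, if Fs x = s ∧ Ft x = t then q x else 0

lemma pushPair_nonneg {X S T : Type*} [Fintype X] [DecidableEq S] [DecidableEq T] {q : X → ℝ}
    {Fs : X → S} {Ft : X → T} (hq : ∀ x, 0 < q x) (s : S) (t : T) :
    0 ≤ pushPair q Fs Ft s t :=
  Finset.sum_nonneg fun x _ => by split_ifs <;> simp [(hq x).le]

lemma pushPair_pos {X S T : Type*} [Fintype X] [DecidableEq S] [DecidableEq T] {q : X → ℝ}
    {Fs : X → S} {Ft : X → T} (hq : ∀ x, 0 < q x) (x : X) :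
    0 < pushPair q Fs Ft (Fs x) (Ft x) := by
  refine Finset.sum_pos' (fun z _ => ?_) ⟨x, Finset.mem_univ x, by simp [hq x]⟩
  split_ifs <;> simp [(hq z).le]

section Pushforward

variable {X S T : Type*} [Fintype X] [Fintype S] [Fintype T] [DecidableEq S] [DecidableEq T]
  {q : X → ℝ} {Fs : X → S} {Ft : X → T}

lemma sum_pushPair_mul (q : X → ℝ) (Fs : X → S) (Ft : X → T) (g : S → T → ℝ) :
    ∑ s, ∑ t, pushPair q Fs Ft s t * g s t = ∑ x, q x * g (Fs x) (Ft x) := by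
  simp_rw [pushPair, Finset.sum_mul]
  rw [Finset.sum_congr rfl fun s _ => Finset.sum_comm, Finset.sum_comm]
  refine Finset.sum_congr rfl fun x _ => ?_
  simp [ite_and, ite_mul]

/-- The density of the pushforward pair with respect to the product of its marginals. -/
def pairDensity (q : X → ℝ) (Fs : X → S) (Ft : X → T) (s : S) (t : T) : ℝ :=
  pushPair q Fs Ft s t /
    ((∑ t', pushPair q Fs Ft s t') * ∑ s', pushPair q Fs Ft s' t)

lemma pairDensity_pos (hq : ∀ x, 0 < q x) (x : X) : 0 < pairDensity q Fs Ft (Fs x) (Ft x) := by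
  refine div_pos (pushPair_pos hq x) (mul_pos ?_ ?_)
  · exact Finset.sum_pos' (fun _ _ => pushPair_nonneg hq _ _)
      ⟨_, Finset.mem_univ _, pushPair_pos hq x⟩
  · exact Finset.sum_pos' (fun _ _ => pushPair_nonneg hq _ _)
      ⟨_, Finset.mem_univ _, pushPair_pos hq x⟩

/-- Dividing by the density decouples the two features, up to mass outside the support. -/
lemma sum_mul_div_pairDensity_le (hq : ∀ x, 0 < q x) {G : S → T → ℝ} (hG : ∀ s t, 0 ≤ G s t) :
    ∑ x, q x * (G (Fs x) (Ft x) / pairDensity q Fs Ft (Fs x) (Ft x)) ≤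
      ∑ u, q u * ∑ v, q v * G (Fs u) (Ft v) := by
  have hR : ∑ u, q u * ∑ v, q v * G (Fs u) (Ft v) =
      ∑ s, ∑ t, (∑ t', pushPair q Fs Ft s t') * (∑ s', pushPair q Fs Ft s' t) * G s t := by
    rw [← sum_pushPair_mul q Fs Ft fun s _ => ∑ v, q v * G s (Ft v)]
    refine Finset.sum_congr rfl fun s _ => ?_
    rw [← Finset.sum_mul, ← sum_pushPair_mul q Fs Ft fun _ t => G s t, Finset.sum_comm,
      Finset.mul_sum]
    refine Finset.sum_congr rfl fun t _ => ?_
    rw [← Finset.sum_mul, mul_assoc]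
  rw [hR, ← sum_pushPair_mul q Fs Ft fun s t => G s t / pairDensity q Fs Ft s t]
  refine Finset.sum_le_sum fun s _ => Finset.sum_le_sum fun t _ => ?_
  have hA : 0 ≤ ∑ t', pushPair q Fs Ft s t' := Finset.sum_nonneg fun _ _ => pushPair_nonneg hq _ _
  have hB : 0 ≤ ∑ s', pushPair q Fs Ft s' t := Finset.sum_nonneg fun _ _ => pushPair_nonneg hq _ _
  rcases (pushPair_nonneg (Fs := Fs) (Ft := Ft) hq s t).eq_or_lt with h | h
  · rw [← h, zero_mul]
    exact mul_nonneg (mul_nonneg hA hB) (hG s t)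
  · refine le_of_eq ?_
    rw [pairDensity, div_div_eq_mul_div]
    field_simp

end Pushforward

lemma sum_prod_insertNth {X : Type*} [Fintype X] {n : ℕ} (q : X → ℝ) (i : Fin (n + 1))
    (F : (Fin (n + 1) → X) → ℝ) :
    ∑ xs, (∏ j, q (xs j)) * F xs =
      ∑ r : Fin n → X, (∏ j, q (r j)) * ∑ x, q x * F (i.insertNth x r) := by
  rw [← (Fin.insertNthEquiv (fun _ => X) i).sum_comp, Fintype.sum_prod_type, Finset.sum_comm]
  refine Finset.sum_congr rfl fun r _ => ?_
  rw [Finset.mul_sum]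
  refine Finset.sum_congr rfl fun x _ => ?_
  simp only [Fin.insertNthEquiv_apply, Fin.prod_univ_succAbove _ i, Fin.insertNth_apply_same,
    Fin.insertNth_apply_succAbove]
  rw [mul_assoc, mul_left_comm]
  rfl

lemma sum_prod_eq_one {X ι : Type*} [Fintype X] [Fintype ι] [DecidableEq ι] {q : X → ℝ}
    (hq1 : ∑ x, q x = 1) : ∑ xs : ι → X, ∏ j, q (xs j) = 1 := by
  rw [← Fintype.prod_sum fun (_ : ι) x => q x]
  simp [hq1]

/-- The unconditional InfoNCE lower bound on mutual information. -/
lemma infoNCE_le_mutualInfo_s0 {X S T : Type*} [Fintype X] [Fintype S] [Fintype T]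
    [DecidableEq S] [DecidableEq T] {q : X → ℝ} (hq : ∀ x, 0 < q x) (hq1 : ∑ x, q x = 1)
    (Fs : X → S) (Ft : X → T) {N : ℕ} (hN : 1 ≤ N) (f : S × T → ℝ) :
    ∑ xs : Fin N → X, (∏ i, q (xs i)) *
      ((1 / (N : ℝ)) * ∑ i, Real.log ((N : ℝ) * Real.exp (f (Fs (xs i), Ft (xs i))) /
        ∑ j, Real.exp (f (Fs (xs i), Ft (xs j))))) ≤
    ∑ s, ∑ t, pushPair q Fs Ft s t * Real.log (pairDensity q Fs Ft s t) := by
  obtain ⟨n, rfl⟩ : ∃ n, N = n + 1 := ⟨N - 1, by omega⟩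
  set I := ∑ s, ∑ t, pushPair q Fs Ft s t * Real.log (pairDensity q Fs Ft s t) with hI
  set c : ℝ := ((n + 1 : ℕ) : ℝ) with hc
  have hc0 : 0 < c := by positivity
  have hdenom : ∀ (s : S) (xs : Fin (n + 1) → X), 0 < ∑ j, Real.exp (f (s, Ft (xs j))) :=
    fun s xs => Finset.sum_pos (fun _ _ => Real.exp_pos _) Finset.univ_nonempty
  let K : Fin (n + 1) → S → (Fin (n + 1) → X) → ℝ := fun i s xs =>
    c * Real.exp (f (s, Ft (xs i))) / ∑ j, Real.exp (f (s, Ft (xs j)))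
  have hK : ∀ i s xs, 0 < K i s xs := fun i s xs =>
    div_pos (mul_pos hc0 (Real.exp_pos _)) (hdenom s xs)
  have hprod : ∀ (m : ℕ) (xs : Fin m → X), 0 ≤ ∏ j, q (xs j) := fun m xs =>
    Finset.prod_nonneg fun j _ => (hq _).le
  have decouple : ∀ i, ∑ xs : Fin (n + 1) → X, (∏ j, q (xs j)) *
      (K i (Fs (xs i)) xs / pairDensity q Fs Ft (Fs (xs i)) (Ft (xs i))) ≤
      ∑ u, q u * ∑ xs : Fin (n + 1) → X, (∏ j, q (xs j)) * K i (Fs u) xs := by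
    intro i
    have hR : ∑ u, q u * ∑ xs : Fin (n + 1) → X, (∏ j, q (xs j)) * K i (Fs u) xs =
        ∑ r : Fin n → X, (∏ j, q (r j)) *
          ∑ u, q u * ∑ v, q v * K i (Fs u) (i.insertNth v r) := by
      simp_rw [sum_prod_insertNth q i, Finset.mul_sum]
      rw [Finset.sum_comm]
      simp_rw [mul_left_comm (q _) (∏ j, q _)]
    rw [hR, sum_prod_insertNth q i]
    refine Finset.sum_le_sum fun r _ => ?_
    refine mul_le_mul_of_nonneg_left ?_ (hprod n r)
    have h := sum_mul_div_pairDensity_le (Fs := Fs) (Ft := Ft) hq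
      (G := fun s t => c * Real.exp (f (s, t)) /
        (Real.exp (f (s, t)) + ∑ j, Real.exp (f (s, Ft (r j)))))
      (fun s t => by positivity)
    simpa [K, Fin.sum_univ_succAbove _ i] using h
  have hlog : ∀ i, ∑ xs : Fin (n + 1) → X, (∏ j, q (xs j)) *
      Real.log (pairDensity q Fs Ft (Fs (xs i)) (Ft (xs i))) = I := by
    intro i
    rw [sum_prod_insertNth q i]
    simp only [Fin.insertNth_apply_same]
    rw [← Finset.sum_mul, sum_prod_eq_one hq1, one_mul, hI,
      sum_pushPair_mul q Fs Ft fun s t => Real.log (pairDensity q Fs Ft s t)]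
  have hterm : ∀ i, ∑ xs : Fin (n + 1) → X, (∏ j, q (xs j)) * Real.log (K i (Fs (xs i)) xs) ≤
      I + (∑ u, q u * ∑ xs : Fin (n + 1) → X, (∏ j, q (xs j)) * K i (Fs u) xs) - 1 := by
    intro i
    have h1 : ∑ xs : Fin (n + 1) → X, (∏ j, q (xs j)) * Real.log (K i (Fs (xs i)) xs) ≤
        ∑ xs : Fin (n + 1) → X, ((∏ j, q (xs j)) *
          Real.log (pairDensity q Fs Ft (Fs (xs i)) (Ft (xs i))) + (∏ j, q (xs j)) *
          (K i (Fs (xs i)) xs / pairDensity q Fs Ft (Fs (xs i)) (Ft (xs i))) -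
          ∏ j, q (xs j)) := by
      refine Finset.sum_le_sum fun xs _ => ?_
      have hr := pairDensity_pos (Fs := Fs) (Ft := Ft) hq (xs i)
      have h := Real.log_le_sub_one_of_pos (div_pos (hK i (Fs (xs i)) xs) hr)
      rw [Real.log_div (hK i _ xs).ne' hr.ne'] at h
      nlinarith [mul_le_mul_of_nonneg_left h (hprod _ xs)]
    rw [Finset.sum_sub_distrib, Finset.sum_add_distrib, hlog i, sum_prod_eq_one hq1] at h1
    linarith [decouple i]
  have htotal : ∑ i, ∑ u, q u * ∑ xs : Fin (n + 1) → X, (∏ j, q (xs j)) * K i (Fs u) xs = c := by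
    have hsumK : ∀ s xs, ∑ i, K i s xs = c := fun s xs => by
      simp only [K]
      rw [← Finset.sum_div, ← Finset.mul_sum, mul_div_assoc, div_self (hdenom s xs).ne', mul_one]
    rw [Finset.sum_comm]
    simp_rw [← Finset.mul_sum]
    have : ∀ u, ∑ i, ∑ xs : Fin (n + 1) → X, (∏ j, q (xs j)) * K i (Fs u) xs = c := fun u => by
      rw [Finset.sum_comm]
      simp_rw [← Finset.mul_sum, hsumK]
      rw [← Finset.sum_mul, sum_prod_eq_one hq1, one_mul]
    simp_rw [this]
    rw [← Finset.sum_mul, hq1, one_mul]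
  have hswap : ∑ xs : Fin (n + 1) → X, (∏ i, q (xs i)) *
      ((1 / c) * ∑ i, Real.log (K i (Fs (xs i)) xs)) =
      (1 / c) * ∑ i, ∑ xs : Fin (n + 1) → X, (∏ j, q (xs j)) * Real.log (K i (Fs (xs i)) xs) := by
    rw [Finset.sum_comm, Finset.mul_sum]
    refine Finset.sum_congr rfl fun xs _ => ?_
    rw [← Finset.mul_sum]
    ring
  refine hswap.trans_le ?_
  have hsum := Finset.sum_le_sum fun i (_ : i ∈ Finset.univ) => hterm i
  rw [Finset.sum_sub_distrib, Finset.sum_add_distrib, htotal] at hsum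
  simp only [Finset.sum_const, Finset.card_univ, Fintype.card_fin, nsmul_eq_mul, mul_one,
    ← hc] at hsum
  rw [one_div, inv_mul_le_iff₀ hc0]
  linarith

lemma jointSTY_div_margY {X Y S T : Type*} [Fintype X] [DecidableEq S] [DecidableEq T]
    (p : X × Y → ℝ) (Fs : X → S) (Ft : X → T) (s : S) (t : T) (y : Y) :
    jointSTY p Fs Ft s t y / margY p y = pushPair (fun x => condX p x y) Fs Ft s t := by
  simp [jointSTY, pushPair, condX, Finset.sum_div, ite_div]

/-- Lemma 1 (conditional InfoNCE lower bound), finite version: for a strictly positive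
pmf `p` on `𝒳 × 𝒴` (finite nonempty types), feature maps `F_s : 𝒳 → 𝒮`, `F_t : 𝒳 → 𝒯`
into finite nonempty types, any `N ≥ 1` and any family of score functions
`f_y : 𝒮 × 𝒯 → ℝ`, we have `−L_info ≤ I(S;T|Y)`. -/
theorem negLinfo_le_condMutualInfo
    {X Y S T : Type*} [Fintype X] [Nonempty X] [Fintype Y] [Nonempty Y]
    [Fintype S] [Nonempty S] [Fintype T] [Nonempty T] [DecidableEq S] [DecidableEq T]
    (p : X × Y → ℝ) (hpos : ∀ z, 0 < p z) (hsum : ∑ z, p z = 1)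
    (Fs : X → S) (Ft : X → T) (N : ℕ) (hN : 1 ≤ N) (f : Y → S × T → ℝ) :
    negLinfo p Fs Ft N f ≤ condMutualInfo p Fs Ft := by
  have hm : ∀ y, 0 < margY p y := fun y =>
    Finset.sum_pos (fun x _ => hpos (x, y)) Finset.univ_nonempty
  refine Finset.sum_le_sum fun y _ => mul_le_mul_of_nonneg_left ?_ (hm y).le
  have h1 : ∑ x, condX p x y = 1 := by
    simp only [condX]
    rw [← Finset.sum_div]
    exact div_self (hm y).ne'
  have h := infoNCE_le_mutualInfo_s0 (q := fun x => condX p x y)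
    (fun x => div_pos (hpos (x, y)) (hm y)) h1 Fs Ft hN (f y)
  simpa only [Finset.sum_div, jointSTY_div_margY, pairDensity] using h

end
end

section
/- Unconditional InfoNCE lower bound on mutual information, finite version. Let 𝒳, 𝒮, 𝒯 be finite nonempty types, let p be a strictly positive probability mass function on 𝒳, and let F_s : 𝒳 → 𝒮 and F_t : 𝒳 → 𝒯 be functions. Fix an integer N ≥ 1 and a score function f : 𝒮 × 𝒯 → ℝ. Then Σ_{(x_1,…,x_N) ∈ 𝒳^N} (Π_{i=1}^N p(x_i)) · (1/N) · Σ_{i=1}^N log( N · exp(f(F_s(x_i), F_t(x_i))) / Σ_{j=1}^N exp(f(F_s(x_i), F_t(x_j))) ) ≤ I(S;T), the mutual information of S = F_s(X) and T = F_t(X), where X is distributed according to p. -/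
noncomputable section

open Finset

/-- Marginal of a pmf on `𝒳` pushed forward to the pair `(F_s x, F_t x)`:
the joint pmf `p_{S,T}(s,t) = Σ_{x : F_s x = s, F_t x = t} p x`. -/
def jointST {X S T : Type*} [Fintype X] [DecidableEq S] [DecidableEq T]
    (p : X → ℝ) (Fs : X → S) (Ft : X → T) (s : S) (t : T) : ℝ :=
  ∑ x, if Fs x = s ∧ Ft x = t then p x else 0

/-- Mutual information `I(S;T)` of the joint pmf of `(F_s X, F_t X)` where `X ~ p`:
`Σ_{s,t} q(s,t) · log (q(s,t) / (q_S(s) · q_T(t)))` (terms with `q(s,t) = 0` vanish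
since they are multiplied by `0`). -/
def mutualInfoST {X S T : Type*} [Fintype X] [Fintype S] [Fintype T]
    [DecidableEq S] [DecidableEq T] (p : X → ℝ) (Fs : X → S) (Ft : X → T) : ℝ :=
  ∑ s, ∑ t, jointST p Fs Ft s t *
    Real.log (jointST p Fs Ft s t /
      ((∑ t', jointST p Fs Ft s t') * (∑ s', jointST p Fs Ft s' t)))

/-- The (unconditional) InfoNCE objective:
`Σ_{(x_1,…,x_N)} (Π_i p(x_i)) · (1/N) Σ_i log (N · e^{f(F_s x_i, F_t x_i)} / Σ_j e^{f(F_s x_i, F_t x_j)})`. -/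
def infoNCE {X S T : Type*} [Fintype X] (p : X → ℝ) (Fs : X → S) (Ft : X → T)
    (N : ℕ) (f : S × T → ℝ) : ℝ :=
  ∑ xs : Fin N → X, (∏ i, p (xs i)) *
    ((1 / (N : ℝ)) * ∑ i, Real.log ((N : ℝ) * Real.exp (f (Fs (xs i), Ft (xs i))) /
      ∑ j, Real.exp (f (Fs (xs i), Ft (xs j)))))

section InfoNCE

variable {X S T : Type*} [Fintype X]

theorem sum_jointST_mul [Fintype S] [Fintype T] [DecidableEq S] [DecidableEq T]
    (p : X → ℝ) (Fs : X → S) (Ft : X → T) (h : S → T → ℝ) :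
    ∑ s, ∑ t, jointST p Fs Ft s t * h s t = ∑ x, p x * h (Fs x) (Ft x) := by
  simp only [jointST, Finset.sum_mul, ite_mul, zero_mul, ite_and]
  calc _ = ∑ s, ∑ x, ∑ t, (if Fs x = s then if Ft x = t then p x * h s t else 0 else 0) :=
        Finset.sum_congr rfl fun s _ => Finset.sum_comm
    _ = ∑ x, ∑ s, ∑ t, (if Fs x = s then if Ft x = t then p x * h s t else 0 else 0) :=
        Finset.sum_comm
    _ = _ := by
        refine Finset.sum_congr rfl fun x _ => ?_
        rw [Finset.sum_eq_single (Fs x)]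
        · simp
        · intro s _ hs
          simp [hs.symm]
        · simp

theorem jointST_nonneg [DecidableEq S] [DecidableEq T]
    {p : X → ℝ} (hp : ∀ x, 0 ≤ p x) (Fs : X → S) (Ft : X → T) (s : S) (t : T) :
    0 ≤ jointST p Fs Ft s t :=
  Finset.sum_nonneg fun x _ => by split_ifs <;> simp [hp x]

theorem jointST_pos [DecidableEq S] [DecidableEq T]
    {p : X → ℝ} (hp : ∀ x, 0 < p x) (Fs : X → S) (Ft : X → T) (x : X) :
    0 < jointST p Fs Ft (Fs x) (Ft x) := by
  refine Finset.sum_pos' (fun y _ => ?_) ⟨x, Finset.mem_univ x, by simp [hp x]⟩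
  split_ifs <;> simp [(hp y).le]

/-- The density ratio of the product of the marginals to the joint pmf. -/
def productRatio [Fintype S] [Fintype T] [DecidableEq S] [DecidableEq T]
    (p : X → ℝ) (Fs : X → S) (Ft : X → T) (s : S) (t : T) : ℝ :=
  ((∑ t', jointST p Fs Ft s t') * (∑ s', jointST p Fs Ft s' t)) / jointST p Fs Ft s t

theorem productRatio_pos [Fintype S] [Fintype T] [DecidableEq S] [DecidableEq T]
    {p : X → ℝ} (hp : ∀ x, 0 < p x) (Fs : X → S) (Ft : X → T) (x : X) :
    0 < productRatio p Fs Ft (Fs x) (Ft x) := by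
  have hq := jointST_nonneg (fun x => (hp x).le) Fs Ft
  have hx := jointST_pos hp Fs Ft x
  refine div_pos (mul_pos ?_ ?_) hx
  · exact Finset.sum_pos' (fun t _ => hq _ t) ⟨Ft x, Finset.mem_univ _, hx⟩
  · exact Finset.sum_pos' (fun s _ => hq s _) ⟨Fs x, Finset.mem_univ _, hx⟩

theorem mutualInfoST_eq_neg_sum_log [Fintype S] [Fintype T] [DecidableEq S] [DecidableEq T]
    (p : X → ℝ) (Fs : X → S) (Ft : X → T) :
    mutualInfoST p Fs Ft = -∑ x, p x * Real.log (productRatio p Fs Ft (Fs x) (Ft x)) := by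
  rw [mutualInfoST, sum_jointST_mul p Fs Ft fun s t => Real.log (jointST p Fs Ft s t /
    ((∑ t', jointST p Fs Ft s t') * (∑ s', jointST p Fs Ft s' t))), ← Finset.sum_neg_distrib]
  refine Finset.sum_congr rfl fun x _ => ?_
  rw [productRatio, ← inv_div, Real.log_inv, mul_neg]

/-- Change of measure from the joint pmf to the product of its marginals. It is only an inequality
because the product may charge pairs that the joint pmf does not. -/
theorem sum_mul_productRatio_mul_le [Fintype S] [Fintype T] [DecidableEq S] [DecidableEq T]
    {p : X → ℝ} (hp : ∀ x, 0 ≤ p x) (Fs : X → S) (Ft : X → T)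
    (g : S → T → ℝ) (hg : ∀ s t, 0 ≤ g s t) :
    ∑ x, p x * (productRatio p Fs Ft (Fs x) (Ft x) * g (Fs x) (Ft x)) ≤
      ∑ y, p y * ∑ x, p x * g (Fs y) (Ft x) := by
  have hq := jointST_nonneg hp Fs Ft
  have hS (k : S → ℝ) : ∑ x, p x * k (Fs x) = ∑ s, (∑ t', jointST p Fs Ft s t') * k s := by
    simp only [Finset.sum_mul, ← sum_jointST_mul p Fs Ft fun s _ => k s]
  have hT (k : T → ℝ) : ∑ x, p x * k (Ft x) = ∑ t, (∑ s', jointST p Fs Ft s' t) * k t := by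
    simp only [Finset.sum_mul, ← sum_jointST_mul p Fs Ft fun _ t => k t]
    exact Finset.sum_comm
  rw [← sum_jointST_mul p Fs Ft fun s t => productRatio p Fs Ft s t * g s t,
    hS fun s => ∑ x, p x * g s (Ft x)]
  refine Finset.sum_le_sum fun s _ => ?_
  rw [hT fun t => g s t, Finset.mul_sum]
  refine Finset.sum_le_sum fun t _ => ?_
  have hS0 := Finset.sum_nonneg fun t' (_ : t' ∈ Finset.univ) => hq s t'
  have hT0 := Finset.sum_nonneg fun s' (_ : s' ∈ Finset.univ) => hq s' t
  rcases (hq s t).eq_or_lt with h | h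
  · rw [← h, zero_mul]
    exact mul_nonneg hS0 (mul_nonneg hT0 (hg s t))
  · refine le_of_eq ?_
    rw [productRatio, ← mul_assoc, mul_div_cancel₀ _ h.ne', mul_assoc]

theorem sum_prod_mul_eq_sum_insertNth (p : X → ℝ) {n : ℕ} (i : Fin (n + 1))
    (H : (Fin (n + 1) → X) → ℝ) :
    ∑ xs : Fin (n + 1) → X, (∏ j, p (xs j)) * H xs =
      ∑ ys : Fin n → X, (∏ j, p (ys j)) * ∑ x, p x * H (i.insertNth x ys) := by
  rw [← (Fin.insertNthEquiv (fun _ => X) i).sum_comp, Fintype.sum_prod_type, Finset.sum_comm]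
  refine Finset.sum_congr rfl fun ys _ => ?_
  rw [Finset.mul_sum]
  refine Finset.sum_congr rfl fun x _ => ?_
  change (∏ j, p ((i.insertNth x ys : Fin (n + 1) → X) j)) * H (i.insertNth x ys) = _
  simp only [Fin.prod_univ_succAbove _ i, Fin.insertNth_apply_same, Fin.insertNth_apply_succAbove]
  ring

theorem sum_prod_eq_one_s1 {p : X → ℝ} (hsum : ∑ x, p x = 1) (n : ℕ) :
    ∑ xs : Fin n → X, ∏ j, p (xs j) = 1 := by
  rw [← Fintype.sum_pow, hsum, one_pow]

theorem sum_prod_mul_apply {p : X → ℝ} (hsum : ∑ x, p x = 1) {n : ℕ} (i : Fin (n + 1))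
    (φ : X → ℝ) :
    ∑ xs : Fin (n + 1) → X, (∏ j, p (xs j)) * φ (xs i) = ∑ x, p x * φ x := by
  rw [sum_prod_mul_eq_sum_insertNth p i fun xs => φ (xs i)]
  simp only [Fin.insertNth_apply_same]
  rw [← Finset.sum_mul, sum_prod_eq_one_s1 hsum, one_mul]

/-- The ratio of the score of `(s, ts i)` to the average score of the pairs `(s, ts j)`. -/
def scoreRatio {n : ℕ} (f : S × T → ℝ) (s : S) (ts : Fin (n + 1) → T) (i : Fin (n + 1)) : ℝ :=
  ((n + 1 : ℕ) : ℝ) * Real.exp (f (s, ts i)) / ∑ j, Real.exp (f (s, ts j))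

theorem scoreRatio_pos {n : ℕ} (f : S × T → ℝ) (s : S) (ts : Fin (n + 1) → T)
    (i : Fin (n + 1)) : 0 < scoreRatio f s ts i := by
  unfold scoreRatio
  positivity

theorem sum_scoreRatio {n : ℕ} (f : S × T → ℝ) (s : S) (ts : Fin (n + 1) → T) :
    ∑ i, scoreRatio f s ts i = ((n + 1 : ℕ) : ℝ) := by
  have h : 0 < ∑ j, Real.exp (f (s, ts j)) := by positivity
  simp only [scoreRatio]
  rw [← Finset.sum_div, ← Finset.mul_sum, mul_div_cancel_right₀ _ h.ne']

theorem sum_prod_mul_productRatio_mul_scoreRatio_le [Fintype S] [Fintype T] [DecidableEq S]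
    [DecidableEq T] {p : X → ℝ} (hp : ∀ x, 0 ≤ p x) (Fs : X → S) (Ft : X → T) {n : ℕ}
    (f : S × T → ℝ) (i : Fin (n + 1)) :
    ∑ xs : Fin (n + 1) → X, (∏ j, p (xs j)) *
        (productRatio p Fs Ft (Fs (xs i)) (Ft (xs i)) * scoreRatio f (Fs (xs i)) (Ft ∘ xs) i) ≤
      ∑ xs : Fin (n + 1) → X, (∏ j, p (xs j)) * ∑ y, p y * scoreRatio f (Fs y) (Ft ∘ xs) i := by
  rw [sum_prod_mul_eq_sum_insertNth p i fun xs => productRatio p Fs Ft (Fs (xs i)) (Ft (xs i)) *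
      scoreRatio f (Fs (xs i)) (Ft ∘ xs) i,
    sum_prod_mul_eq_sum_insertNth p i fun xs => ∑ y, p y * scoreRatio f (Fs y) (Ft ∘ xs) i]
  refine Finset.sum_le_sum fun ys _ =>
    mul_le_mul_of_nonneg_left ?_ (Finset.prod_nonneg fun j _ => hp _)
  have hcomp (x : X) : Ft ∘ (i.insertNth x ys : Fin (n + 1) → X) =
      (i.insertNth (Ft x) (Ft ∘ ys) : Fin (n + 1) → T) := by
    funext j
    refine Fin.succAboveCases i ?_ (fun k => ?_) j <;> simp
  simp only [hcomp, Fin.insertNth_apply_same]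
  refine (sum_mul_productRatio_mul_le hp Fs Ft
    (fun s t => scoreRatio f s (i.insertNth t (Ft ∘ ys) : Fin (n + 1) → T) i)
    fun s t => (scoreRatio_pos f s _ i).le).trans_eq ?_
  simp only [Finset.mul_sum]
  rw [Finset.sum_comm]
  exact Finset.sum_congr rfl fun x _ => Finset.sum_congr rfl fun y _ => mul_left_comm _ _ _

theorem sum_prod_mul_log_scoreRatio_le [Fintype S] [Fintype T] [DecidableEq S]
    [DecidableEq T] {p : X → ℝ} (hp : ∀ x, 0 < p x) (hsum : ∑ x, p x = 1)
    (Fs : X → S) (Ft : X → T) {n : ℕ} (f : S × T → ℝ) (i : Fin (n + 1)) :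
    ∑ xs : Fin (n + 1) → X, (∏ j, p (xs j)) *
        Real.log (scoreRatio f (Fs (xs i)) (Ft ∘ xs) i) ≤
      mutualInfoST p Fs Ft + (∑ xs : Fin (n + 1) → X, (∏ j, p (xs j)) *
        ∑ y, p y * scoreRatio f (Fs y) (Ft ∘ xs) i - 1) := by
  have hlog : ∑ xs : Fin (n + 1) → X, (∏ j, p (xs j)) *
        (Real.log (productRatio p Fs Ft (Fs (xs i)) (Ft (xs i))) +
          Real.log (scoreRatio f (Fs (xs i)) (Ft ∘ xs) i)) ≤
      ∑ xs : Fin (n + 1) → X, (∏ j, p (xs j)) *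
        (productRatio p Fs Ft (Fs (xs i)) (Ft (xs i)) *
          scoreRatio f (Fs (xs i)) (Ft ∘ xs) i - 1) := by
    refine Finset.sum_le_sum fun xs _ =>
      mul_le_mul_of_nonneg_left ?_ (Finset.prod_nonneg fun j _ => (hp _).le)
    have h₁ := productRatio_pos hp Fs Ft (xs i)
    have h₂ := scoreRatio_pos f (Fs (xs i)) (Ft ∘ xs) i
    rw [← Real.log_mul h₁.ne' h₂.ne']
    exact Real.log_le_sub_one_of_pos (mul_pos h₁ h₂)
  simp only [mul_add, mul_sub, mul_one, Finset.sum_add_distrib, Finset.sum_sub_distrib] at hlog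
  rw [sum_prod_mul_apply hsum i fun x => Real.log (productRatio p Fs Ft (Fs x) (Ft x)),
    sum_prod_eq_one_s1 hsum] at hlog
  have hchange := sum_prod_mul_productRatio_mul_scoreRatio_le (fun x => (hp x).le) Fs Ft f i
  rw [mutualInfoST_eq_neg_sum_log]
  linarith

end InfoNCE

/-- Unconditional InfoNCE lower bound on mutual information, finite version:
for a strictly positive pmf `p` on a finite nonempty `𝒳`, maps `F_s : 𝒳 → 𝒮`,
`F_t : 𝒳 → 𝒯` into finite nonempty types, any `N ≥ 1` and any score function
`f : 𝒮 × 𝒯 → ℝ`, the InfoNCE objective is at most `I(S;T)`. -/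
theorem infoNCE_le_mutualInfo
    {X S T : Type*} [Fintype X] [Nonempty X] [Fintype S] [Nonempty S]
    [Fintype T] [Nonempty T] [DecidableEq S] [DecidableEq T]
    (p : X → ℝ) (hpos : ∀ x, 0 < p x) (hsum : ∑ x, p x = 1)
    (Fs : X → S) (Ft : X → T) (N : ℕ) (hN : 1 ≤ N) (f : S × T → ℝ) :
    infoNCE p Fs Ft N f ≤ mutualInfoST p Fs Ft := by
  obtain ⟨n, rfl⟩ := Nat.exists_eq_add_of_le' hN
  have hN0 : (0 : ℝ) < ((n + 1 : ℕ) : ℝ) := by positivity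
  have hmass : ∑ i, ∑ xs : Fin (n + 1) → X, (∏ j, p (xs j)) *
      ∑ y, p y * scoreRatio f (Fs y) (Ft ∘ xs) i = ((n + 1 : ℕ) : ℝ) := by
    rw [Finset.sum_comm]
    simp only [← Finset.mul_sum]
    simp_rw [Finset.sum_comm (s := (Finset.univ : Finset (Fin (n + 1)))), ← Finset.mul_sum,
      sum_scoreRatio, ← Finset.sum_mul, hsum, sum_prod_eq_one_s1 hsum, one_mul]
  have hle := Finset.sum_le_sum fun i (_ : i ∈ Finset.univ) =>
    sum_prod_mul_log_scoreRatio_le hpos hsum Fs Ft f (n := n) i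
  rw [Finset.sum_add_distrib, Finset.sum_sub_distrib, hmass] at hle
  simp only [Finset.sum_const, Finset.card_univ, Fintype.card_fin, nsmul_eq_mul, mul_one,
    sub_self, add_zero] at hle
  have heq : infoNCE p Fs Ft (n + 1) f = (1 / ((n + 1 : ℕ) : ℝ)) *
      ∑ i, ∑ xs : Fin (n + 1) → X, (∏ j, p (xs j)) *
        Real.log (scoreRatio f (Fs (xs i)) (Ft ∘ xs) i) := by
    rw [Finset.sum_comm, Finset.mul_sum]
    refine Finset.sum_congr rfl fun xs _ => ?_
    rw [← Finset.mul_sum, mul_left_comm]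
    rfl
  rw [heq, one_div, inv_mul_le_iff₀ hN0]
  exact hle

end
end

section
/- Optimality of the density-ratio critic for the contrastive loss (the claim that the optimal exp(f_y(s,t)) minimizing L_info is proportional to p(t|s,y)/p(t|y)), finite version. Let 𝒮, 𝒯 be finite nonempty types, let π be a strictly positive probability mass function on 𝒮 × 𝒯 with marginals π_S and π_T, and fix an integer N ≥ 1. For a function f : 𝒮 × 𝒯 → ℝ define L(f) = Σ_{((s_1,t_1),…,(s_N,t_N)) ∈ (𝒮×𝒯)^N} (Π_{i=1}^N π(s_i,t_i)) · (1/N) · Σ_{i=1}^N ( −log( exp(f(s_i,t_i)) / Σ_{j=1}^N exp(f(s_i,t_j)) ) ). Let f*(s,t) = log( π(s,t) / (π_S(s) · π_T(t)) ). Then L(f*) ≤ L(f) for every function f : 𝒮 × 𝒯 → ℝ. -/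
noncomputable section

open Finset

/-- The `S`-marginal `π_S(s) = Σ_t π(s,t)`. -/
def margS {S T : Type*} [Fintype T] (π : S × T → ℝ) (s : S) : ℝ :=
  ∑ t, π (s, t)

/-- The `T`-marginal `π_T(t) = Σ_s π(s,t)`. -/
def margT {S T : Type*} [Fintype S] (π : S × T → ℝ) (t : T) : ℝ :=
  ∑ s, π (s, t)

/-- The expected contrastive (InfoNCE cross-entropy) loss of a critic `f`:
`L(f) = Σ_{((s_1,t_1),…,(s_N,t_N))} (Π_i π(s_i,t_i)) · (1/N) Σ_i
  (−log (e^{f(s_i,t_i)} / Σ_j e^{f(s_i,t_j)}))`,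
the expected categorical cross-entropy of identifying the matched sample `t_i`
among `{t_1,…,t_N}` given `s_i`, when the `N` pairs are i.i.d. from `π`. -/
def contrastLoss {S T : Type*} [Fintype S] [Fintype T] (π : S × T → ℝ) (N : ℕ)
    (f : S × T → ℝ) : ℝ :=
  ∑ ps : Fin N → S × T, (∏ i, π (ps i)) *
    ((1 / (N : ℝ)) * ∑ i, -Real.log (Real.exp (f (ps i)) /
      ∑ j, Real.exp (f ((ps i).1, (ps j).2))))

/-- The density ratio `π(s,t) / (π_S(s) π_T(t))`. -/
def densityRatio {S T : Type*} [Fintype S] [Fintype T] (π : S × T → ℝ) (z : S × T) : ℝ :=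
  π z / (margS π z.1 * margT π z.2)

lemma margS_pos {S T : Type*} [Fintype T] [Nonempty T] {π : S × T → ℝ}
    (hpos : ∀ z, 0 < π z) (s : S) : 0 < margS π s :=
  sum_pos (fun _ _ => hpos _) univ_nonempty

lemma margT_pos {S T : Type*} [Fintype S] [Nonempty S] {π : S × T → ℝ}
    (hpos : ∀ z, 0 < π z) (t : T) : 0 < margT π t :=
  sum_pos (fun _ _ => hpos _) univ_nonempty

lemma densityRatio_pos {S T : Type*} [Fintype S] [Nonempty S] [Fintype T] [Nonempty T]
    {π : S × T → ℝ} (hpos : ∀ z, 0 < π z) (z : S × T) : 0 < densityRatio π z :=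
  div_pos (hpos z) (mul_pos (margS_pos hpos _) (margT_pos hpos _))

lemma sum_prod_eq_one_s6 {ι α : Type*} [Fintype ι] [DecidableEq ι] [Fintype α]
    {p : α → ℝ} (hsum : ∑ z, p z = 1) : ∑ x : ι → α, ∏ k, p (x k) = 1 := by
  rw [← Fintype.piFinset_univ, ← Finset.prod_univ_sum (fun _ => univ) (fun _ => p)]
  simp [hsum]

/-- Summing out all first coordinates except the `i`-th one. -/
lemma sum_prod_mul_apply_s6 {ι S : Type*} [Fintype ι] [DecidableEq ι] [Fintype S]
    (p : ι → S → ℝ) (g : S → ℝ) (i : ι) :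
    ∑ σ : ι → S, (∏ k, p k (σ k)) * g (σ i) =
      ∏ k, ∑ s, p k s * (if k = i then g s else 1) := by
  rw [Finset.prod_univ_sum, Fintype.piFinset_univ]
  refine sum_congr rfl fun σ _ => ?_
  rw [prod_mul_distrib, prod_ite_eq' univ i]
  simp

/-- Under i.i.d. pairs, the law of `(s_i, t_1, …, t_N)` has density `r(s_i, t_i)` with respect to
the product of the marginals, where `r` is the density ratio. -/
lemma sum_pairs_eq_sum_marginals {ι S T : Type*} [Fintype ι] [DecidableEq ι]
    [Fintype S] [Nonempty S] [Fintype T] [Nonempty T]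
    {π : S × T → ℝ} (hpos : ∀ z, 0 < π z) (G : S → (ι → T) → ℝ) (i : ι) :
    ∑ ps : ι → S × T, (∏ k, π (ps k)) * G (ps i).1 (fun k => (ps k).2) =
      ∑ t : ι → T, ∑ s, (∏ k, margT π (t k)) * margS π s *
        (densityRatio π (s, t i) * G s t) := by
  rw [← (Equiv.arrowProdEquivProdArrow ι (fun _ => S) (fun _ => T)).symm.sum_comp,
    Fintype.sum_prod_type_right]
  refine sum_congr rfl fun t _ => ?_
  refine (sum_prod_mul_apply_s6 (fun k s => π (s, t k)) (fun s => G s t) i).trans ?_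
  have hfac : ∀ k, ∑ s, π (s, t k) * (if k = i then G s t else 1) =
      margT π (t k) * (if k = i then
        ∑ s, margS π s * (densityRatio π (s, t i) * G s t) else 1) := by
    intro k
    split_ifs with h
    · subst h
      rw [mul_sum]
      refine sum_congr rfl fun s _ => ?_
      have h1 := (margS_pos hpos s).ne'
      have h2 := (margT_pos hpos (t k)).ne'
      simp only [densityRatio]
      field_simp
    · simp [margT]
  rw [prod_congr rfl fun k _ => hfac k, prod_mul_distrib, prod_ite_eq' univ i]
  simp [mul_sum, mul_assoc]

/-- The softmax probability assigned by the positive scores `w` to the `i`-th candidate. -/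
def matchProb {ι S T : Type*} [Fintype ι] (w : S × T → ℝ) (i : ι) (s : S) (t : ι → T) : ℝ :=
  w (s, t i) / ∑ j, w (s, t j)

lemma matchProb_pos {ι S T : Type*} [Fintype ι] {w : S × T → ℝ} (hw : ∀ z, 0 < w z)
    (i : ι) (s : S) (t : ι → T) : 0 < matchProb w i s t :=
  div_pos (hw _) (sum_pos (fun _ _ => hw _) ⟨i, mem_univ i⟩)

lemma sum_matchProb {ι S T : Type*} [Fintype ι] [Nonempty ι] {w : S × T → ℝ}
    (hw : ∀ z, 0 < w z) (s : S) (t : ι → T) : ∑ i, matchProb w i s t = 1 := by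
  simp only [matchProb]
  rw [← sum_div, div_self (sum_pos (fun _ _ => hw _) univ_nonempty).ne']

/-- The likelihood ratio against the density-ratio critic has total mass one. -/
lemma sum_matchProb_div {ι S T : Type*} [Fintype ι] [DecidableEq ι] [Nonempty ι]
    [Fintype S] [Nonempty S] [Fintype T] [Nonempty T]
    {π : S × T → ℝ} (hpos : ∀ z, 0 < π z) (hsum : ∑ z, π z = 1)
    {w : S × T → ℝ} (hw : ∀ z, 0 < w z) :
    ∑ i : ι, ∑ ps : ι → S × T, (∏ k, π (ps k)) *
      (matchProb w i (ps i).1 (fun k => (ps k).2) /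
        matchProb (densityRatio π) i (ps i).1 (fun k => (ps k).2)) = Fintype.card ι := by
  have hr := densityRatio_pos hpos
  have key : ∀ (i : ι) (s : S) (t : ι → T),
      densityRatio π (s, t i) * (matchProb w i s t / matchProb (densityRatio π) i s t) =
        matchProb w i s t * ∑ j, densityRatio π (s, t j) := by
    intro i s t
    have h1 := (hr (s, t i)).ne'
    have h2 : ∑ j, densityRatio π (s, t j) ≠ 0 :=
      (sum_pos (fun _ _ => hr _) univ_nonempty).ne'
    rw [matchProb.eq_1 (densityRatio π)]
    field_simp
  have hone : ∀ j : ι, ∑ t : ι → T, ∑ s, (∏ k, margT π (t k)) * margS π s *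
      densityRatio π (s, t j) = 1 := by
    intro j
    have := sum_pairs_eq_sum_marginals hpos (fun _ _ => 1) j
    simpa [sum_prod_eq_one_s6 hsum] using this.symm
  calc _ = ∑ i : ι, ∑ t : ι → T, ∑ s, (∏ k, margT π (t k)) * margS π s *
        (matchProb w i s t * ∑ j, densityRatio π (s, t j)) := by
        refine sum_congr rfl fun i _ => ?_
        rw [sum_pairs_eq_sum_marginals hpos
          (fun s t => matchProb w i s t / matchProb (densityRatio π) i s t) i]
        simp only [key]
    _ = ∑ t : ι → T, ∑ s, ∑ j, (∏ k, margT π (t k)) * margS π s *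
        densityRatio π (s, t j) := by
        rw [sum_comm]
        refine sum_congr rfl fun t _ => ?_
        rw [sum_comm]
        refine sum_congr rfl fun s _ => ?_
        rw [← mul_sum, ← sum_mul, sum_matchProb hw, one_mul, mul_sum]
    _ = ∑ j : ι, ∑ t : ι → T, ∑ s, (∏ k, margT π (t k)) * margS π s *
        densityRatio π (s, t j) := by
        exact (sum_comm.trans (sum_congr rfl fun t _ => sum_comm)).symm
    _ = Fintype.card ι := by simp [hone]

lemma one_sub_div_le_neg_log_sub {x y : ℝ} (hx : 0 < x) (hy : 0 < y) :
    1 - x / y ≤ -Real.log x - -Real.log y := by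
  have := Real.log_le_sub_one_of_pos (div_pos hx hy)
  rw [Real.log_div hx.ne' hy.ne'] at this
  linarith

/-- Optimality of the density-ratio critic for the contrastive loss, finite version:
for a strictly positive pmf `π` on `𝒮 × 𝒯` (finite nonempty types) and any `N ≥ 1`,
the critic `f*(s,t) = log (π(s,t) / (π_S(s) · π_T(t)))` minimizes `L`:
`L(f*) ≤ L(f)` for every `f : 𝒮 × 𝒯 → ℝ`. -/
theorem contrastLoss_optimal_critic
    {S T : Type*} [Fintype S] [Nonempty S] [Fintype T] [Nonempty T]
    (π : S × T → ℝ) (hpos : ∀ z, 0 < π z) (hsum : ∑ z, π z = 1)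
    (N : ℕ) (hN : 1 ≤ N) (f : S × T → ℝ) :
    contrastLoss π N (fun z => Real.log (π z / (margS π z.1 * margT π z.2))) ≤
      contrastLoss π N f := by
  have : Nonempty (Fin N) := ⟨⟨0, hN⟩⟩
  have hr := densityRatio_pos hpos
  have hloss : ∀ g : S × T → ℝ, contrastLoss π N g = (1 / (N : ℝ)) *
      ∑ i, ∑ ps : Fin N → S × T, (∏ k, π (ps k)) *
        -Real.log (matchProb (fun z => Real.exp (g z)) i (ps i).1 (fun k => (ps k).2)) := by
    intro g
    rw [sum_comm, mul_sum]
    refine sum_congr rfl fun ps _ => ?_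
    rw [← mul_sum, mul_left_comm]
    rfl
  have hexp : (fun z => Real.exp (Real.log (π z / (margS π z.1 * margT π z.2)))) =
      densityRatio π := funext fun z => Real.exp_log (hr z)
  rw [hloss, hloss, hexp]
  refine mul_le_mul_of_nonneg_left ?_ (by positivity)
  rw [← sub_nonneg, ← sum_sub_distrib]
  have hw : ∀ z, 0 < Real.exp (f z) := fun z => Real.exp_pos _
  have hzero : ∑ i : Fin N, ∑ ps : Fin N → S × T, (∏ k, π (ps k)) *
      (1 - matchProb (fun z => Real.exp (f z)) i (ps i).1 (fun k => (ps k).2) /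
        matchProb (densityRatio π) i (ps i).1 (fun k => (ps k).2)) = 0 := by
    simp only [mul_sub, mul_one, sum_sub_distrib, sum_prod_eq_one_s6 hsum]
    rw [sum_matchProb_div hpos hsum hw]
    simp
  rw [← hzero]
  refine sum_le_sum fun i _ => ?_
  rw [← sum_sub_distrib]
  refine sum_le_sum fun ps _ => ?_
  rw [← mul_sub]
  exact mul_le_mul_of_nonneg_left
    (one_sub_div_le_neg_log_sub (matchProb_pos hw _ _ _) (matchProb_pos hr _ _ _))
    (prod_nonneg fun _ _ => (hpos _).le)

end
end
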